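/- arXiv:math/0307224 — 2 statements merged into one kernel-verified Lean document; each statement's English description precedes it below -/
import Mathlib

section
/- Let Δ be a quasi-tree with at least two facets and let F be a leaf of Δ. Then the simplicial complex ⟨ℱ(Δ)∖{F}⟩ generated by the facets of Δ other than F is again a quasi-tree. -/
open Finset

/-- A simplicial complex on the vertex set `Fin n`: contains all singletons and is
closed under taking subsets. -/
def IsComplex {n : ℕ} (Δ : Set (Finset (Fin n))) : Prop :=
  (∀ i : Fin n, {i} ∈ Δ) ∧ ∀ F ∈ Δ, ∀ G ⊆ F, G ∈ Δ

/-- Closed under taking subsets (a simplicial complex, singletons not required). -/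
def IsLowerComplex {n : ℕ} (Δ : Set (Finset (Fin n))) : Prop :=
  ∀ F ∈ Δ, ∀ G ⊆ F, G ∈ Δ

/-- The set of facets (maximal faces) of `Δ`. -/
def facets {n : ℕ} (Δ : Set (Finset (Fin n))) : Set (Finset (Fin n)) :=
  {F | F ∈ Δ ∧ ∀ G ∈ Δ, F ⊆ G → F = G}

/-- The simplicial complex generated by a family of subsets of `Fin n`. -/
def gen {n : ℕ} (S : Set (Finset (Fin n))) : Set (Finset (Fin n)) :=
  {G | ∃ F ∈ S, G ⊆ F}

/-- `F` is a leaf of `Δ`: either `F` is the only facet, or there is a facet `G ≠ F`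
(a branch of `F`) with `H ∩ F ⊆ G ∩ F` for every facet `H ≠ F`. -/
def IsLeaf {n : ℕ} (Δ : Set (Finset (Fin n))) (F : Finset (Fin n)) : Prop :=
  F ∈ facets Δ ∧
    (facets Δ = {F} ∨ ∃ G ∈ facets Δ, G ≠ F ∧ ∀ H ∈ facets Δ, H ≠ F → H ∩ F ⊆ G ∩ F)

/-- `Δ` is a quasi-tree: there is a labeling `F₁, …, F_m` of its facets such that `F_i`
is a leaf of `⟨F₁, …, F_i⟩` for every `i` (a leaf order). -/
def IsQuasiTree {n : ℕ} (Δ : Set (Finset (Fin n))) : Prop :=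
  ∃ L : List (Finset (Fin n)), L.Nodup ∧ {F | F ∈ L} = facets Δ ∧
    ∀ i : Fin L.length, IsLeaf (gen {F | F ∈ L.take (i.1 + 1)}) (L.get i)

/-- `Δ` is pure: all facets have the same cardinality. -/
def IsPure {n : ℕ} (Δ : Set (Finset (Fin n))) : Prop :=
  ∀ F ∈ facets Δ, ∀ G ∈ facets Δ, F.card = G.card

/-- `Δ` is shellable: it is pure and there is an order `F₁, …, F_m` of its facets such
that for all `j < i` and `x ∈ F_i \ F_j` there is `k < i` with `F_i \ F_k = {x}`. -/
def IsShellable {n : ℕ} (Δ : Set (Finset (Fin n))) : Prop :=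
  IsPure Δ ∧ ∃ L : List (Finset (Fin n)), L.Nodup ∧ {F | F ∈ L} = facets Δ ∧
    ∀ i j : Fin L.length, j < i →
      ∀ x ∈ L.get i \ L.get j, ∃ k : Fin L.length, k < i ∧ L.get i \ L.get k = {x}

/-- The `i`-skeleton of `Δ`: the complex generated by the faces of dimension `i`. -/
def skel {n : ℕ} (Δ : Set (Finset (Fin n))) (i : ℕ) : Set (Finset (Fin n)) :=
  gen {F | F ∈ Δ ∧ F.card = i + 1}

/-- The Alexander dual of `Δ`: `Δ^∨ = {[n] \ F : F ∉ Δ}`. -/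
def dual {n : ℕ} (Δ : Set (Finset (Fin n))) : Set (Finset (Fin n)) :=
  {G | Gᶜ ∉ Δ}

/-- `Δ^c`, the complex generated by the complements of the facets of `Δ`. -/
def complements {n : ℕ} (Δ : Set (Finset (Fin n))) : Set (Finset (Fin n)) :=
  gen ((·ᶜ) '' facets Δ)

/-- `Δ` is flag: every minimal nonface has exactly two elements. -/
def IsFlag {n : ℕ} (Δ : Set (Finset (Fin n))) : Prop :=
  ∀ F : Finset (Fin n), F ∉ Δ → (∀ G ⊂ F, G ∈ Δ) → F.card = 2

/-- The squarefree monomial `x_F = ∏_{i ∈ F} x_i`. -/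
noncomputable def xF {n : ℕ} (K : Type) [Field K] (F : Finset (Fin n)) :
    MvPolynomial (Fin n) K := ∏ i ∈ F, MvPolynomial.X i

/-- The Stanley–Reisner ideal of `Δ`, generated by the monomials `x_F` with `F` a
nonface of `Δ`. -/
noncomputable def SRIdeal {n : ℕ} (K : Type) [Field K] (Δ : Set (Finset (Fin n))) :
    Ideal (MvPolynomial (Fin n) K) := Ideal.span (xF K '' {F | F ∉ Δ})

/-- The facet ideal of `Δ`, generated by the monomials `x_F` with `F` a facet of `Δ`. -/
noncomputable def facetIdeal {n : ℕ} (K : Type) [Field K] (Δ : Set (Finset (Fin n))) :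
    Ideal (MvPolynomial (Fin n) K) := Ideal.span (xF K '' facets Δ)

/-- A set `G` of monomials (assumed to be the minimal monomial generating set of the
ideal it generates) has linear quotients: there is an order `f₁, …, f_m` of `G` such
that each colon ideal `(f₁,…,f_{i-1}) : f_i` is generated by a set of variables. -/
def HasLinearQuotients {n : ℕ} (K : Type) [Field K]
    (G : Set (MvPolynomial (Fin n) K)) : Prop :=
  ∃ L : List (MvPolynomial (Fin n) K), L.Nodup ∧ {f | f ∈ L} = G ∧
    ∀ i : Fin L.length, 0 < i.1 →
      ∃ V : Set (Fin n),
        Submodule.colon (Ideal.span {f | f ∈ L.take i.1}) (Ideal.span {L.get i}) =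
          Ideal.span (MvPolynomial.X '' V)

/-- The clique complex `Δ(G)` of a graph `G`: faces are the cliques of `G`. -/
def cliqueComplex {n : ℕ} (G : SimpleGraph (Fin n)) : Set (Finset (Fin n)) :=
  {F | ∀ i ∈ F, ∀ j ∈ F, i ≠ j → G.Adj i j}

/-- A graph is chordal if every cycle of length at least 4 has a chord, i.e. an edge of
the graph joining two vertices of the cycle which is not an edge of the cycle. -/
def IsChordalGraph {V : Type} (G : SimpleGraph V) : Prop :=
  ∀ (v : V) (c : G.Walk v v), c.IsCycle → 4 ≤ c.length →
    ∃ x y, G.Adj x y ∧ x ∈ c.support ∧ y ∈ c.support ∧ s(x, y) ∉ c.edges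

/-- A module `M` over `S` has projective dimension at most one: some (equivalently, by
Schanuel's lemma, any) presentation of `M` by a free module has projective kernel. -/
def ProjDimLEOne (S : Type) [CommRing S] (M : Type) [AddCommGroup M] [Module S M] : Prop :=
  ∃ (ι : Type) (f : (ι →₀ S) →ₗ[S] M), Function.Surjective f ∧
    Module.Projective S (LinearMap.ker f)

/-- The monomial with exponent vector `a`. -/
noncomputable def mono {n : ℕ} (K : Type) [Field K] (a : Fin n → ℕ) :
    MvPolynomial (Fin n) K := MvPolynomial.monomial (Finsupp.equivFunOnFinite.symm a) 1

/-- The Taylor relation `r_{ij} = u_{ji} e_i - u_{ij} e_j` for the monomials with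
exponent vectors `a i`, `a j`, where `u_{ij} = u_i / gcd(u_i, u_j)`. -/
noncomputable def taylorRel {n t : ℕ} (K : Type) [Field K] (a : Fin t → Fin n → ℕ)
    (i j : Fin t) : Fin t → MvPolynomial (Fin n) K :=
  Pi.single i (mono K (a j - a i ⊓ a j)) - Pi.single j (mono K (a i - a i ⊓ a j))

/-- A face `F` is attached to a family `S` along a single member of `S` (or `S` is empty). -/
def IsAttached {α : Type*} [DecidableEq α] (S : Set (Finset α)) (F : Finset α) : Prop :=
  S = ∅ ∨ ∃ G ∈ S, ∀ H ∈ S, H ∩ F ⊆ G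

/-- Families of sets built by successively attaching new members: the set-based form of a
leaf order. -/
inductive IsLeafBuilt {α : Type*} [DecidableEq α] : Set (Finset α) → Prop
  | empty : IsLeafBuilt ∅
  | attach {S : Set (Finset α)} {F : Finset α} (hS : IsLeafBuilt S) (hF : F ∉ S)
      (h : IsAttached S F) : IsLeafBuilt (insert F S)

theorem isAntichain_facets {n : ℕ} (Δ : Set (Finset (Fin n))) :
    IsAntichain (· ⊆ ·) (facets Δ) :=
  fun _ hF _ hG hne hsub => hne (hF.2 _ hG.1 hsub)

theorem facets_gen {n : ℕ} {S : Set (Finset (Fin n))} (hS : IsAntichain (· ⊆ ·) S) :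
    facets (gen S) = S := by
  ext F
  constructor
  · rintro ⟨⟨G, hG, hFG⟩, hmax⟩
    rw [hmax G ⟨G, hG, subset_rfl⟩ hFG]
    exact hG
  · intro hF
    refine ⟨⟨F, hF, subset_rfl⟩, ?_⟩
    rintro G ⟨K, hK, hGK⟩ hFG
    have : F = K := hS.eq hF hK (hFG.trans hGK)
    subst this
    exact hFG.antisymm hGK

theorem isLeaf_iff_isAttached {n : ℕ} {Δ : Set (Finset (Fin n))} {F : Finset (Fin n)} :
    IsLeaf Δ F ↔ F ∈ facets Δ ∧ IsAttached (facets Δ \ {F}) F := by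
  refine and_congr_right fun hF => or_congr ?_ ?_
  · rw [Set.sdiff_eq_empty, Set.Subset.antisymm_iff, Set.singleton_subset_iff]
    simp [hF]
  · simp only [Set.mem_sdiff, Set.mem_singleton_iff, and_assoc, and_imp,
      Finset.subset_inter_iff, Finset.inter_subset_right, and_true]

theorem isLeaf_gen_insert_iff {n : ℕ} {S : Set (Finset (Fin n))} {F : Finset (Fin n)}
    (hS : IsAntichain (· ⊆ ·) (insert F S)) (hF : F ∉ S) :
    IsLeaf (gen (insert F S)) F ↔ IsAttached S F := by
  rw [isLeaf_iff_isAttached, facets_gen hS, Set.insert_sdiff_self_of_notMem hF]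
  simp

theorem setOf_mem_concat {α : Type*} (L : List α) (a : α) :
    {x | x ∈ L ++ [a]} = insert a {x | x ∈ L} := by
  ext x
  simp [or_comm]

theorem forall_take_get_concat {α : Type*} (P : Set α → α → Prop) (L : List α) (a : α) :
    (∀ i : Fin (L ++ [a]).length, P {x | x ∈ (L ++ [a]).take (i.1 + 1)} ((L ++ [a]).get i)) ↔
      (∀ i : Fin L.length, P {x | x ∈ L.take (i.1 + 1)} (L.get i)) ∧
        P (insert a {x | x ∈ L}) a := by
  have take_lt (i : ℕ) (hi : i < L.length) : (L ++ [a]).take (i + 1) = L.take (i + 1) :=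
    List.take_append_of_le_length hi
  have take_length : (L ++ [a]).take (L.length + 1) = L ++ [a] :=
    List.take_of_length_le (by simp)
  constructor
  · intro h
    refine ⟨fun i => ?_, ?_⟩
    · have := h ⟨i, by simp⟩
      simpa only [take_lt i i.2, List.get_eq_getElem, List.getElem_append_left i.2] using this
    · have := h ⟨L.length, by simp⟩
      simpa only [take_length, setOf_mem_concat, List.get_eq_getElem,
        List.getElem_concat_length] using this
  · rintro ⟨h, ha⟩ ⟨i, hi⟩
    rcases Nat.lt_or_ge i L.length with hlt | hge
    · simpa only [take_lt i hlt, List.get_eq_getElem, List.getElem_append_left hlt]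
        using h ⟨i, hlt⟩
    · obtain rfl : i = L.length := by simp at hi; omega
      simpa only [take_length, setOf_mem_concat, List.get_eq_getElem,
        List.getElem_concat_length] using ha

theorem IsLeafBuilt.of_list {n : ℕ} (L : List (Finset (Fin n))) (hnd : L.Nodup)
    (hL : IsAntichain (· ⊆ ·) {F | F ∈ L})
    (h : ∀ i : Fin L.length, IsLeaf (gen {F | F ∈ L.take (i.1 + 1)}) (L.get i)) :
    IsLeafBuilt {F | F ∈ L} := by
  induction L using List.reverseRecOn with
  | nil => simpa using IsLeafBuilt.empty
  | append_singleton L a ih =>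
    rw [forall_take_get_concat (fun S F => IsLeaf (gen S) F)] at h
    rw [setOf_mem_concat] at hL ⊢
    have ha : a ∉ L ∧ L.Nodup := by simpa [List.nodup_append, and_comm, imp_not_comm] using hnd
    exact .attach (ih ha.2 (hL.subset (Set.subset_insert _ _)) h.1) ha.1
      ((isLeaf_gen_insert_iff hL ha.1).1 h.2)

theorem IsLeafBuilt.exists_list {n : ℕ} {S : Set (Finset (Fin n))} (h : IsLeafBuilt S)
    (hS : IsAntichain (· ⊆ ·) S) :
    ∃ L : List (Finset (Fin n)), L.Nodup ∧ {F | F ∈ L} = S ∧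
      ∀ i : Fin L.length, IsLeaf (gen {F | F ∈ L.take (i.1 + 1)}) (L.get i) := by
  induction h with
  | empty => exact ⟨[], List.nodup_nil, by simp, fun i => i.elim0⟩
  | @attach S a _ ha hatt ih =>
    obtain ⟨L, hnd, rfl, hL⟩ := ih (hS.subset (Set.subset_insert _ _))
    refine ⟨L ++ [a], ?_, setOf_mem_concat L a, ?_⟩
    · exact List.nodup_append.2 ⟨hnd, by simp, by grind⟩
    · rw [forall_take_get_concat (fun S F => IsLeaf (gen S) F)]
      exact ⟨hL, (isLeaf_gen_insert_iff hS ha).2 hatt⟩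

theorem isQuasiTree_iff_isLeafBuilt {n : ℕ} {Δ : Set (Finset (Fin n))} :
    IsQuasiTree Δ ↔ IsLeafBuilt (facets Δ) := by
  constructor
  · rintro ⟨L, hnd, hL, h⟩
    rw [← hL]
    exact .of_list L hnd (hL ▸ isAntichain_facets Δ) h
  · exact fun h => h.exists_list (isAntichain_facets Δ)

/-- A member may be exchanged for a new set having the same intersections with the other
members. -/
theorem IsLeafBuilt.exchange {α : Type*} [DecidableEq α] {S : Set (Finset α)}
    (h : IsLeafBuilt S) {E F : Finset α} (hF : F ∈ S) (hE : E ∉ S)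
    (hEF : ∀ H ∈ S, H ≠ F → H ∩ F = H ∩ E) : IsLeafBuilt (insert E (S \ {F})) := by
  induction h with
  | empty => simp at hF
  | @attach S K hS hK hatt ih =>
    rw [Set.mem_insert_iff, not_or] at hE
    by_cases hKF : K = F
    · subst hKF
      rw [Set.insert_sdiff_self_of_notMem hK]
      refine .attach hS hE.2 (hatt.imp_right ?_)
      rintro ⟨G, hG, hGb⟩
      refine ⟨G, hG, fun H hH => ?_⟩
      rw [← hEF H (Or.inr hH) (by rintro rfl; exact hK hH)]
      exact hGb H hH
    · have hFS : F ∈ S := hF.resolve_left (Ne.symm hKF)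
      have hKEF : K ∩ F = K ∩ E := hEF K (Or.inl rfl) hKF
      rw [Set.insert_sdiff_of_notMem _ (by simpa using hKF), Set.insert_comm]
      refine .attach (ih hFS hE.2 fun H hH => hEF H (Or.inr hH)) ?_ (Or.inr ?_)
      · rintro (h | h)
        exacts [hE.1 h.symm, hK h.1]
      · obtain rfl | ⟨G, hG, hGb⟩ := hatt
        · exact hFS.elim
        · by_cases hGF : G = F
          · subst hGF
            refine ⟨E, Or.inl rfl, ?_⟩
            rintro H (rfl | ⟨hH, -⟩)
            · exact Finset.inter_subset_left
            · intro x hx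
              have hxK := (Finset.mem_inter.1 hx).2
              exact (Finset.mem_inter.1 (hKEF ▸ Finset.mem_inter.2 ⟨hxK, hGb H hH hx⟩)).2
          · refine ⟨G, Or.inr ⟨hG, hGF⟩, ?_⟩
            rintro H (rfl | ⟨hH, -⟩)
            · rw [Finset.inter_comm, ← hKEF, Finset.inter_comm]
              exact hGb F hFS
            · exact hGb H hH

theorem IsLeafBuilt.diff_singleton {α : Type*} [DecidableEq α] {S : Set (Finset α)}
    (h : IsLeafBuilt S) {F : Finset α} (hF : F ∈ S) (hatt : IsAttached (S \ {F}) F) :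
    IsLeafBuilt (S \ {F}) := by
  induction h with
  | empty => simp at hF
  | @attach S E hS hE hEatt ih =>
    by_cases hEF : E = F
    · subst hEF
      rwa [Set.insert_sdiff_self_of_notMem hE]
    have hFS : F ∈ S := hF.resolve_left (Ne.symm hEF)
    rw [Set.insert_sdiff_of_notMem _ (by simpa using hEF)] at hatt ⊢
    obtain rfl | ⟨B, hB, hBb⟩ := hEatt
    · exact hFS.elim
    obtain h0 | ⟨G, hG, hGb⟩ := hatt
    · exact ((Set.insert_nonempty _ _).ne_empty h0).elim
    have extend (hatt' : IsAttached (S \ {F}) F) (C : Finset α) (hC : C ∈ S \ {F})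
        (hCb : ∀ H ∈ S \ {F}, H ∩ E ⊆ C) : IsLeafBuilt (insert E (S \ {F})) :=
      .attach (ih hFS hatt') (fun h => hE h.1) (Or.inr ⟨C, hC, hCb⟩)
    by_cases hBF : B = F
    · subst hBF
      obtain rfl | hG := hG
      · exact hS.exchange hFS hE fun H hH hne => by
          have h1 := hGb H (Or.inr ⟨hH, hne⟩)
          have h2 := hBb H hH
          grind
      · refine extend (Or.inr ⟨G, hG, fun H hH => hGb H (Or.inr hH)⟩) G hG fun H hH => ?_
        have h1 := hGb H (Or.inr hH)
        have h2 := hBb H hH.1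
        grind
    · have hBS : B ∈ S \ {F} := ⟨hB, hBF⟩
      refine extend ?_ B hBS fun H hH => hBb H hH.1
      obtain rfl | hG := hG
      · refine Or.inr ⟨B, hBS, fun H hH => ?_⟩
        have h1 := hGb H (Or.inr hH)
        have h2 := hBb H hH.1
        grind
      · exact Or.inr ⟨G, hG, fun H hH => hGb H (Or.inr hH)⟩

/-- If `Δ` is a quasi-tree with at least two facets and `F` is a leaf of
`Δ`, then the complex generated by the facets of `Δ` other than `F` is again a
quasi-tree. -/
theorem stmt_15 {n : ℕ} (Δ : Set (Finset (Fin n))) (hΔ : IsLowerComplex Δ)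
    (hq : IsQuasiTree Δ) (h2 : ∃ F ∈ facets Δ, ∃ G ∈ facets Δ, F ≠ G)
    (F : Finset (Fin n)) (hF : IsLeaf Δ F) :
    IsQuasiTree (gen (facets Δ \ {F})) := by
  rw [isLeaf_iff_isAttached] at hF
  rw [isQuasiTree_iff_isLeafBuilt] at hq ⊢
  rw [facets_gen ((isAntichain_facets Δ).subset Set.sdiff_subset)]
  exact hq.diff_singleton hF.1 hF.2
end

section
/- Let Δ be a quasi-tree of dimension d−1 on [n] and let 1 ≤ ℓ ≤ d−1. Then the ideal I(\overline{skel_Δ(ℓ)}) ⊆ S, generated by the monomials x_F with F an (ℓ+1)-element subset of [n] that is not a face of Δ, has linear quotients. -/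
open Finset

/-- Combinatorial linear quotients for an ordered list of squarefree monomials (given by their
supports): if `G` precedes `F`, then some `y ∈ G \ F` admits `H` preceding `F` with
`H ⊆ F ∪ {y}`. -/
def LinQuotList {α : Type*} [DecidableEq α] (L : List (Finset α)) : Prop :=
  ∀ (P : List (Finset α)) (F : Finset α) (Q : List (Finset α)), L = P ++ F :: Q →
    ∀ G ∈ P, ∃ y ∈ G \ F, ∃ H ∈ P, H ⊆ insert y F

/-- A family of finite sets that admits a linear quotient order. -/
def LinQuotFamily {α : Type*} [DecidableEq α] (S : Set (Finset α)) : Prop :=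
  ∃ L : List (Finset α), L.Nodup ∧ (∀ F, F ∈ L ↔ F ∈ S) ∧ LinQuotList L

theorem LinQuotFamily.empty {α : Type*} [DecidableEq α] :
    LinQuotFamily (∅ : Set (Finset α)) :=
  ⟨[], by simp, by simp, by intro P F Q h; simp at h⟩

theorem LinQuotFamily.singleton {α : Type*} [DecidableEq α] (A : Finset α) :
    LinQuotFamily ({A} : Set (Finset α)) := by
  refine ⟨[A], by simp, by simp, ?_⟩
  intro P F Q h G hG
  cases P with
  | nil => simp at hG
  | cons a P => simp at h

/-- If every member of `B` contains a member of `A` and no member of either family contains `v`,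
then the sets `A ∪ {v}` followed by `B` have linear quotients. -/
theorem LinQuotFamily.insert_union {α : Type*} [DecidableEq α] {v : α} {A B : Set (Finset α)}
    (hA : LinQuotFamily A) (hB : LinQuotFamily B) (hvA : ∀ F ∈ A, v ∉ F)
    (hvB : ∀ F ∈ B, v ∉ F) (hAB : ∀ F ∈ B, ∃ G ∈ A, G ⊆ F) :
    LinQuotFamily (insert v '' A ∪ B) := by
  obtain ⟨LA, hAn, hAm, hAq⟩ := hA
  obtain ⟨LB, hBn, hBm, hBq⟩ := hB
  have key : ∀ (P : List (Finset α)) (F : Finset α) (Q : List (Finset α)), LA.map (insert v) = P ++ F :: Q → ∀ G ∈ P, ∃ y ∈ G \ F, ∃ H ∈ P,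
      H ⊆ insert y F := by
    intro P F Q h G hG
    obtain ⟨P', R', rfl, rfl, h2⟩ := List.map_eq_append_iff.1 h
    obtain ⟨F', Q', rfl, rfl, rfl⟩ := List.map_eq_cons_iff.1 h2
    obtain ⟨G', hG', rfl⟩ := List.mem_map.1 hG
    obtain ⟨y, hy, H, hH, hHs⟩ := hAq P' F' Q' rfl G' hG'
    have hyG := (mem_sdiff.1 hy).1
    have hvG : v ∉ G' := hvA _ ((hAm _).1 (by simp [hG']))
    refine ⟨y, ?_, insert v H, List.mem_map_of_mem hH, ?_⟩
    · have : y ≠ v := by rintro rfl; exact hvG hyG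
      simp_all
    · rw [Finset.insert_comm]
      exact insert_subset_insert _ hHs
  refine ⟨LA.map (insert v) ++ LB, ?_, ?_, ?_⟩
  · refine List.Nodup.append ?_ hBn ?_
    · refine List.Nodup.map_on ?_ hAn
      intro x hx y hy hxy
      rw [← erase_insert (hvA x ((hAm x).1 hx)), hxy, erase_insert (hvA y ((hAm y).1 hy))]
    · intro F hF hF'
      obtain ⟨G, -, rfl⟩ := List.mem_map.1 hF
      exact hvB _ ((hBm _).1 hF') (mem_insert_self _ _)
  · intro F
    simp [hAm, hBm]
  · intro P F Q h G hG
    rcases List.append_eq_append_iff.1 h with ⟨P', rfl, h2⟩ | ⟨R, h1, h2⟩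
    · have hFB : F ∈ B := (hBm F).1 (by simp [h2])
      rcases List.mem_append.1 hG with hG | hG
      · obtain ⟨G', hG', rfl⟩ := List.mem_map.1 hG
        obtain ⟨H, hH, hHF⟩ := hAB F hFB
        exact ⟨v, by simp [hvB F hFB], insert v H,
          List.mem_append_left _ (List.mem_map_of_mem ((hAm H).2 hH)),
          insert_subset_insert _ hHF⟩
      · obtain ⟨y, hy, H, hH, hHs⟩ := hBq P' F Q h2 G hG
        exact ⟨y, hy, H, List.mem_append_right _ hH, hHs⟩
    · cases R with
      | nil =>
        rw [List.append_nil] at h1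
        have hFB : F ∈ B := (hBm F).1 (by
          rw [List.nil_append] at h2
          simp [← h2])
        rw [← h1] at hG ⊢
        obtain ⟨G', hG', rfl⟩ := List.mem_map.1 hG
        obtain ⟨H, hH, hHF⟩ := hAB F hFB
        exact ⟨v, by simp [hvB F hFB], insert v H, List.mem_map_of_mem ((hAm H).2 hH),
          insert_subset_insert _ hHF⟩
      | cons a R =>
        obtain ⟨rfl, -⟩ : F = a ∧ Q = R ++ LB := by simpa using h2
        exact key P F R h1 G hG

theorem linQuotFamily_powersetCard {α : Type*} [DecidableEq α] (U : Finset α) (j : ℕ) :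
    LinQuotFamily {A : Finset α | A ⊆ U ∧ A.card = j} := by
  induction U using Finset.induction_on generalizing j with
  | empty =>
    cases j with
    | zero =>
      convert LinQuotFamily.singleton (∅ : Finset α) using 1
      ext A; simp
    | succ j =>
      convert LinQuotFamily.empty (α := α) using 1
      ext A; simp +contextual
  | insert v U hv ih =>
    cases j with
    | zero =>
      convert LinQuotFamily.singleton (∅ : Finset α) using 1
      ext A; simp +contextual
    | succ j =>
      convert LinQuotFamily.insert_union (v := v) (ih j) (ih (j + 1))
        (fun F hF h => hv (hF.1 h)) (fun F hF h => hv (hF.1 h)) ?_ using 1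
      · ext A
        simp only [Set.mem_ofPred_eq, Set.mem_union, Set.mem_image]
        constructor
        · rintro ⟨h1, h2⟩
          by_cases hvA : v ∈ A
          · refine Or.inl ⟨A.erase v, ⟨subset_insert_iff.1 h1, ?_⟩, insert_erase hvA⟩
            rw [card_erase_of_mem hvA, h2]; rfl
          · exact Or.inr ⟨(subset_insert_iff_of_notMem hvA).1 h1, h2⟩
        · rintro (⟨A, ⟨h1, h2⟩, rfl⟩ | ⟨h1, h2⟩)
          · exact ⟨insert_subset_insert _ h1, by rw [card_insert_of_notMem (fun h => hv (h1 h)), h2]⟩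
          · exact ⟨h1.trans (subset_insert _ _), h2⟩
      · rintro F ⟨h1, h2⟩
        obtain ⟨G, hG, hc⟩ := exists_subset_card_eq (s := F) (n := j) (by lia)
        exact ⟨G, ⟨hG.trans h1, hc⟩, hG⟩

theorem exists_subset_card_eq_not_subset {α : Type*} [DecidableEq α] {F N : Finset α} {j : ℕ}
    (hj : 1 ≤ j) (hF : j ≤ F.card) (hN : ¬ F ⊆ N) : ∃ G ⊆ F, G.card = j ∧ ¬ G ⊆ N := by
  obtain ⟨x, hxF, hxN⟩ := not_subset.1 hN
  obtain ⟨G, hxG, hGF, hc⟩ := exists_subsuperset_card_eq (s := {x}) (t := F) (n := j)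
    (by simpa using hxF) (by simpa using hj) hF
  exact ⟨G, hGF, hc, fun h => hxN (h (hxG (mem_singleton_self x)))⟩

theorem linQuotFamily_not_subset {α : Type*} [DecidableEq α] (U N : Finset α) (j : ℕ) :
    LinQuotFamily {A : Finset α | A ⊆ U ∧ A.card = j ∧ ¬ A ⊆ N} := by
  induction U using Finset.induction_on generalizing j with
  | empty =>
    convert LinQuotFamily.empty (α := α) using 1
    ext A; simp +contextual
  | insert v U hv ih =>
    cases j with
    | zero =>
      convert LinQuotFamily.empty (α := α) using 1
      ext A; simp +contextual
    | succ j =>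
      by_cases hvN : v ∈ N
      · cases j with
        | zero =>
          convert ih 1 using 1
          ext A
          simp only [Set.mem_ofPred_eq, zero_add, card_eq_one]
          constructor
          · rintro ⟨h1, ⟨a, rfl⟩, h3⟩
            have : a ≠ v := by rintro rfl; simp_all
            simp_all
          · rintro ⟨h1, h2, h3⟩
            exact ⟨h1.trans (subset_insert _ _), h2, h3⟩
        | succ j =>
          convert LinQuotFamily.insert_union (v := v) (ih (j + 1)) (ih (j + 2))
            (fun F hF h => hv (hF.1 h)) (fun F hF h => hv (hF.1 h)) ?_ using 1
          · ext A
            simp only [Set.mem_ofPred_eq, Set.mem_union, Set.mem_image]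
            constructor
            · rintro ⟨h1, h2, h3⟩
              by_cases hvA : v ∈ A
              · refine Or.inl ⟨A.erase v, ⟨subset_insert_iff.1 h1, ?_, ?_⟩, insert_erase hvA⟩
                · rw [card_erase_of_mem hvA, h2]; rfl
                · rwa [← subset_insert_iff, insert_eq_of_mem hvN]
              · exact Or.inr ⟨(subset_insert_iff_of_notMem hvA).1 h1, h2, h3⟩
            · rintro (⟨A, ⟨h1, h2, h3⟩, rfl⟩ | ⟨h1, h2, h3⟩)
              · exact ⟨insert_subset_insert _ h1,
                  by rw [card_insert_of_notMem (fun h => hv (h1 h)), h2],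
                  fun h => h3 ((subset_insert _ _).trans h)⟩
              · exact ⟨h1.trans (subset_insert _ _), h2, h3⟩
          · rintro F ⟨h1, h2, h3⟩
            obtain ⟨G, hG, hc, hGN⟩ :=
              exists_subset_card_eq_not_subset (j := j + 1) (by lia) (by lia) h3
            exact ⟨G, ⟨hG.trans h1, hc, hGN⟩, hG⟩
      · convert LinQuotFamily.insert_union (v := v) (linQuotFamily_powersetCard U j) (ih (j + 1))
          (fun F hF h => hv (hF.1 h)) (fun F hF h => hv (hF.1 h)) ?_ using 1
        · ext A
          simp only [Set.mem_ofPred_eq, Set.mem_union, Set.mem_image]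
          constructor
          · rintro ⟨h1, h2, h3⟩
            by_cases hvA : v ∈ A
            · refine Or.inl ⟨A.erase v, ⟨subset_insert_iff.1 h1, ?_⟩, insert_erase hvA⟩
              rw [card_erase_of_mem hvA, h2]; rfl
            · exact Or.inr ⟨(subset_insert_iff_of_notMem hvA).1 h1, h2, h3⟩
          · rintro (⟨A, ⟨h1, h2⟩, rfl⟩ | ⟨h1, h2, h3⟩)
            · exact ⟨insert_subset_insert _ h1,
                by rw [card_insert_of_notMem (fun h => hv (h1 h)), h2],
                fun h => hvN (h (mem_insert_self _ _))⟩
            · exact ⟨h1.trans (subset_insert _ _), h2, h3⟩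
        · rintro F ⟨h1, h2, h3⟩
          obtain ⟨G, hG, hc⟩ := exists_subset_card_eq (s := F) (n := j) (by lia)
          exact ⟨G, ⟨hG.trans h1, hc⟩, hG⟩

/-- The vertex set `U` can be built by successively adding a vertex `v` whose faces among the
previous vertices are exactly the subsets of a single set `N` (a perfect elimination order,
read backwards). -/
inductive HasElimOrder {α : Type*} [DecidableEq α] (Δ : Set (Finset α)) : Finset α → Prop
  | empty : HasElimOrder Δ ∅
  | cons (v : α) (U N : Finset α) (hv : v ∉ U) (hU : HasElimOrder Δ U)
      (hN : ∀ A ⊆ U, insert v A ∈ Δ ↔ A ⊆ N) : HasElimOrder Δ (insert v U)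

theorem HasElimOrder.congr {α : Type*} [DecidableEq α] {Δ Δ' : Set (Finset α)} {U : Finset α}
    (h : HasElimOrder Δ U) (hΔ : ∀ A ⊆ U, A.Nonempty → (A ∈ Δ ↔ A ∈ Δ')) :
    HasElimOrder Δ' U := by
  induction h with
  | empty => exact .empty
  | cons v U N hv hU hN ih =>
    refine .cons v U N hv (ih fun A hA => hΔ A (hA.trans (subset_insert _ _))) fun A hA => ?_
    rw [← hN A hA, hΔ _ (insert_subset_insert _ hA) (insert_nonempty _ _)]

theorem HasElimOrder.linQuotFamily {α : Type*} [DecidableEq α] {Δ : Set (Finset α)}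
    {U : Finset α} (h : HasElimOrder Δ U) (hΔ : ∀ F ∈ Δ, ∀ G ⊆ F, G ∈ Δ) {k : ℕ} (hk : 1 ≤ k) :
    LinQuotFamily {F : Finset α | F ⊆ U ∧ F.card = k + 1 ∧ F ∉ Δ} := by
  induction h with
  | empty =>
    convert LinQuotFamily.empty (α := α) using 1
    ext A; simp +contextual
  | cons v U N hv hU hN ih =>
    convert LinQuotFamily.insert_union (v := v) (linQuotFamily_not_subset U N k) ih
      (fun F hF h => hv (hF.1 h)) (fun F hF h => hv (hF.1 h)) ?_ using 1
    · ext A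
      simp only [Set.mem_ofPred_eq, Set.mem_union, Set.mem_image]
      constructor
      · rintro ⟨h1, h2, h3⟩
        by_cases hvA : v ∈ A
        · have hA := subset_insert_iff.1 h1
          refine Or.inl ⟨A.erase v, ⟨hA, ?_, ?_⟩, insert_erase hvA⟩
          · rw [card_erase_of_mem hvA, h2]; rfl
          · rwa [← hN _ hA, insert_erase hvA]
        · exact Or.inr ⟨(subset_insert_iff_of_notMem hvA).1 h1, h2, h3⟩
      · rintro (⟨A, ⟨h1, h2, h3⟩, rfl⟩ | ⟨h1, h2, h3⟩)
        · exact ⟨insert_subset_insert _ h1,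
            by rw [card_insert_of_notMem (fun h => hv (h1 h)), h2],
            fun h => h3 ((hN A h1).1 h)⟩
        · exact ⟨h1.trans (subset_insert _ _), h2, h3⟩
    · rintro F ⟨h1, h2, h3⟩
      have hFN : ¬ F ⊆ N := fun h => h3 (hΔ _ ((hN F h1).2 h) _ (subset_insert _ _))
      obtain ⟨G, hG, hc, hGN⟩ := exists_subset_card_eq_not_subset hk (by lia) hFN
      exact ⟨G, ⟨hG.trans h1, hc, hGN⟩, hG⟩

/-- Adding one generator `F` to a complex extends an elimination order, provided that the
intersection of `F` with the old vertices is an old face. -/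
theorem HasElimOrder.union_facet {n : ℕ} {S : Set (Finset (Fin n))} {V F : Finset (Fin n)}
    (hV : HasElimOrder (gen S) V) (hSV : ∀ G ∈ S, G ⊆ V)
    (hF : ∀ A ⊆ V, A.Nonempty → A ⊆ F → A ∈ gen S) :
    HasElimOrder (gen (insert F S)) (V ∪ F) := by
  have h0 : HasElimOrder (gen (insert F S)) V := by
    refine hV.congr fun A hA hAn => ⟨?_, ?_⟩
    · rintro ⟨G, hG, hAG⟩
      exact ⟨G, Or.inr hG, hAG⟩
    · rintro ⟨G, rfl | hG, hAG⟩
      · exact hF A hA hAn hAG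
      · exact ⟨G, hG, hAG⟩
  have step : ∀ T ⊆ F, HasElimOrder (gen (insert F S)) (V ∪ T) := by
    intro T
    induction T using Finset.induction_on with
    | empty => intro _; simpa using h0
    | insert v T hv ih =>
      intro hT
      have hvF : v ∈ F := hT (mem_insert_self _ _)
      have hT' := ih ((subset_insert _ _).trans hT)
      rw [union_insert]
      by_cases hvV : v ∈ V
      · rwa [insert_eq_of_mem (mem_union_left _ hvV)]
      · refine .cons v _ F (by simp [hv, hvV]) hT' fun A hA => ⟨?_, fun h => ?_⟩
        · rintro ⟨G, rfl | hG, hAG⟩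
          · exact (subset_insert _ _).trans hAG
          · exact absurd (hSV G hG (hAG (mem_insert_self _ _))) hvV
        · exact ⟨F, Or.inl rfl, insert_subset hvF h⟩
  exact step F subset_rfl

theorem facets_gen_eq {n : ℕ} {S : Set (Finset (Fin n))}
    (hS : ∀ F ∈ S, ∀ G ∈ S, F ⊆ G → F = G) : facets (gen S) = S := by
  ext F
  constructor
  · rintro ⟨⟨G, hG, hFG⟩, h⟩
    rwa [h G ⟨G, hG, subset_rfl⟩ hFG]
  · intro hF
    refine ⟨⟨F, hF, subset_rfl⟩, ?_⟩
    rintro G ⟨H, hH, hGH⟩ hFG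
    obtain rfl := hS F hF H hH (hFG.trans hGH)
    exact hFG.antisymm hGH

theorem exists_facet_superset {n : ℕ} {Δ : Set (Finset (Fin n))} {F : Finset (Fin n)}
    (hF : F ∈ Δ) : ∃ G ∈ facets Δ, F ⊆ G := by
  obtain ⟨G, hFG, hG⟩ := (Set.toFinite Δ).exists_le_maximal hF
  exact ⟨G, ⟨hG.prop, fun H hH hGH => hG.eq_of_le hH hGH⟩, hFG⟩

theorem IsQuasiTree.hasElimOrder {n : ℕ} {Δ : Set (Finset (Fin n))} (hΔ : IsComplex Δ)
    (hq : IsQuasiTree Δ) : HasElimOrder Δ univ := by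
  obtain ⟨L, hnd, hL, hleaf⟩ := hq
  have hmem : ∀ F, F ∈ L ↔ F ∈ facets Δ := fun F => by rw [← hL]; rfl
  have hanti : ∀ k, ∀ F ∈ {F | F ∈ L.take k}, ∀ G ∈ {F | F ∈ L.take k}, F ⊆ G → F = G :=
    fun k F hF G hG hFG => ((hmem F).1 (List.mem_of_mem_take hF)).2 G
      ((hmem G).1 (List.mem_of_mem_take hG)).1 hFG
  have main : ∀ k ≤ L.length,
      HasElimOrder (gen {F | F ∈ L.take k}) ((L.take k).toFinset.sup id) := by
    intro k
    induction k with
    | zero => intro _; simpa using HasElimOrder.empty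
    | succ k ih =>
      intro hk
      have hk' : k < L.length := hk
      have hlf := (hleaf ⟨k, hk'⟩).2
      simp only [List.get_eq_getElem] at hlf
      rw [facets_gen_eq (hanti (k + 1))] at hlf
      have htake : L.take (k + 1) = L.take k ++ [L[k]] := by
        rw [List.take_concat_get']
      have hnot : L[k] ∉ L.take k := by
        have h := hnd.sublist (List.take_sublist (k + 1) L)
        rw [htake, List.nodup_append] at h
        intro hx
        exact h.2.2 _ hx _ (by simp) rfl
      have hset : {F | F ∈ L.take (k + 1)} = insert L[k] {F | F ∈ L.take k} := by
        ext F; simp only [htake, List.mem_append, List.mem_singleton, Set.mem_ofPred_eq,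
          Set.mem_insert_iff]; tauto
      have hsup : (L.take (k + 1)).toFinset.sup id = (L.take k).toFinset.sup id ∪ L[k] := by
        rw [htake, List.toFinset_append, sup_union]; simp
      rw [hset] at hlf
      rw [hset, hsup]
      refine (ih hk'.le).union_facet ?_ ?_
      · intro G hG
        exact le_sup (f := id) (List.mem_toFinset.2 hG)
      · rintro A hAV ⟨x, hx⟩ hAF
        have hcov : ∀ x ∈ A, ∃ H ∈ L.take k, x ∈ H := fun x hx => by
          simpa [mem_sup] using hAV hx
        rcases hlf with h | ⟨G, hG, hGne, hH⟩
        · obtain ⟨H, hH, -⟩ := hcov x hx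
          have : H ∈ ({L[k]} : Set _) := h ▸ Or.inr hH
          rw [Set.mem_singleton_iff] at this
          exact absurd (this ▸ hH) hnot
        · refine ⟨G, hG.resolve_left hGne, fun y hy => ?_⟩
          obtain ⟨H, hHm, hyH⟩ := hcov y hy
          exact (mem_inter.1 (hH H (Or.inr hHm) (fun e => hnot (e ▸ hHm))
            (mem_inter.2 ⟨hyH, hAF hy⟩))).1
  have h := main L.length le_rfl
  rw [List.take_length, hL] at h
  have huniv : L.toFinset.sup id = univ := by
    refine eq_univ_of_forall fun i => ?_
    obtain ⟨G, hG, hiG⟩ := exists_facet_superset (hΔ.1 i)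
    exact mem_sup.2 ⟨G, List.mem_toFinset.2 ((hmem G).2 hG), by simpa using hiG⟩
  rw [huniv] at h
  exact h.congr fun A _ _ =>
    ⟨fun ⟨G, hG, hAG⟩ => hΔ.2 G hG.1 A hAG, fun hA => exists_facet_superset hA⟩

theorem xF_eq_monomial {n : ℕ} (K : Type) [Field K] (F : Finset (Fin n)) :
    xF K F = MvPolynomial.monomial (∑ i ∈ F, Finsupp.single i 1) 1 := by
  rw [xF, MvPolynomial.monomial_sum_one]
  rfl

theorem sum_single_one_apply {α : Type*} [DecidableEq α] (F : Finset α) (y : α) :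
    (∑ i ∈ F, Finsupp.single i 1 : α →₀ ℕ) y = if y ∈ F then 1 else 0 := by
  simp [Finsupp.finsetSum_apply, Finsupp.single_apply]

theorem xF_injective {n : ℕ} (K : Type) [Field K] :
    Function.Injective (xF K : Finset (Fin n) → MvPolynomial (Fin n) K) := by
  intro F G h
  rw [xF_eq_monomial, xF_eq_monomial] at h
  have h' := MvPolynomial.monomial_left_injective (one_ne_zero : (1 : K) ≠ 0) h
  ext y
  have := DFunLike.congr_fun h' y
  rw [sum_single_one_apply, sum_single_one_apply] at this
  split_ifs at this <;> simp_all

/-- The combinatorial exchange property computes the colon ideal as an ideal of variables. -/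
theorem colon_span_xF_eq {n : ℕ} (K : Type) [Field K] (S : Set (Finset (Fin n)))
    (F : Finset (Fin n)) (hS : ∀ G ∈ S, ∃ y ∈ G \ F, ∃ H ∈ S, H ⊆ insert y F) :
    Submodule.colon (Ideal.span (xF K '' S)) (Ideal.span {xF K F} : Ideal _) =
      Ideal.span (MvPolynomial.X '' {y | ∃ H ∈ S, H ⊆ insert y F}) := by
  have hmem : ∀ p, p ∈ Submodule.colon (Ideal.span (xF K '' S)) (Ideal.span {xF K F} : Ideal _) ↔
      p * xF K F ∈ Ideal.span (xF K '' S) := by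
    intro p
    rw [Submodule.mem_colon]
    constructor
    · intro h
      exact h _ (Ideal.mem_span_singleton_self _)
    · intro h q hq
      obtain ⟨r, rfl⟩ := Ideal.mem_span_singleton'.1 hq
      rw [smul_eq_mul, mul_left_comm]
      exact Ideal.mul_mem_left _ _ h
  apply le_antisymm
  · intro p hp
    rw [hmem] at hp
    have himg : xF K '' S = (fun s => MvPolynomial.monomial s (1 : K)) ''
        ((fun G : Finset (Fin n) => ∑ i ∈ G, Finsupp.single i 1) '' S) := by
      rw [Set.image_image]
      exact Set.image_congr fun G _ => xF_eq_monomial K G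
    rw [himg, MvPolynomial.mem_ideal_span_monomial_image] at hp
    rw [MvPolynomial.mem_ideal_span_X_image]
    intro m hm
    obtain ⟨-, ⟨G, hG, rfl⟩, hle⟩ := hp (m + ∑ i ∈ F, Finsupp.single i 1) (by
      rw [MvPolynomial.mem_support_iff, xF_eq_monomial, MvPolynomial.coeff_mul_monomial, mul_one]
      exact MvPolynomial.mem_support_iff.1 hm)
    obtain ⟨y, hy, H, hH, hHF⟩ := hS G hG
    refine ⟨y, ⟨H, hH, hHF⟩, fun h0 => ?_⟩
    have := hle y
    rw [mem_sdiff] at hy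
    simp only [Finsupp.add_apply, sum_single_one_apply, hy.1, hy.2, h0] at this
    simp at this
  · rw [Ideal.span_le]
    rintro _ ⟨y, ⟨H, hH, hHF⟩, rfl⟩
    rw [SetLike.mem_coe, hmem]
    have hdvd : xF K H ∣ MvPolynomial.X y * xF K F := by
      refine (prod_dvd_prod_of_subset _ _ _ hHF).trans ?_
      by_cases hy : y ∈ F
      · rw [insert_eq_of_mem hy]
        exact dvd_mul_left _ _
      · rw [prod_insert hy]; rfl
    exact Ideal.mem_of_dvd _ hdvd (Ideal.subset_span ⟨H, hH, rfl⟩)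

theorem LinQuotFamily.hasLinearQuotients {n : ℕ} (K : Type) [Field K]
    {S : Set (Finset (Fin n))} (hS : LinQuotFamily S) : HasLinearQuotients K (xF K '' S) := by
  obtain ⟨L, hnd, hm, hq⟩ := hS
  refine ⟨L.map (xF K), hnd.map (xF_injective K), ?_, ?_⟩
  · ext f
    simp [hm]
  · rintro ⟨i, hi⟩ -
    have hi' : i < L.length := by simpa using hi
    have hsplit : L = L.take i ++ L[i] :: L.drop (i + 1) := by
      rw [← List.drop_eq_getElem_cons hi', List.take_append_drop]
    refine ⟨{y | ∃ H ∈ {H | H ∈ L.take i}, H ⊆ insert y L[i]}, ?_⟩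
    rw [← colon_span_xF_eq K {H | H ∈ L.take i} L[i] (hq _ _ _ hsplit)]
    have himg : {f | f ∈ (L.map (xF K)).take i} = xF K '' {H | H ∈ L.take i} := by
      ext f
      simp [← List.map_take]
    simp [himg]

/-- Let `Δ` be a quasi-tree of dimension `d - 1` on `[n]` and
`1 ≤ ℓ ≤ d - 1`.  Then the ideal `I(\overline{skel_Δ(ℓ)})`, generated by the monomials
`x_F` with `F` an `(ℓ+1)`-element subset of `[n]` that is not a face of `Δ`, has
linear quotients. -/
theorem stmt_17 {n d ℓ : ℕ} (K : Type) [Field K] (Δ : Set (Finset (Fin n)))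
    (hΔ : IsComplex Δ) (hq : IsQuasiTree Δ)
    (hdim : ∀ F ∈ Δ, F.card ≤ d) (hdim' : ∃ F ∈ Δ, F.card = d)
    (hl1 : 1 ≤ ℓ) (hl2 : ℓ + 1 ≤ d) :
    HasLinearQuotients K (xF K '' {F : Finset (Fin n) | F.card = ℓ + 1 ∧ F ∉ Δ}) := by
  have h := (hq.hasElimOrder hΔ).linQuotFamily hΔ.2 hl1
  simpa only [subset_univ, true_and] using h.hasLinearQuotients K
end
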